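/- Let A be a standard Young tableau of shape α (a partition of a), and let j ≥ 0 be an integer. Then Σ q^{maj(σ^{>j})}, where the sum is over all permutations σ ∈ S_a whose Robinson–Schensted insertion tableau P(σ) equals A and such that j ∈ J(σ), equals Σ_{μ ⊢ j} f^{α/μ}(q), the sum over partitions μ of j (with μ ⊆ α) of the q-generating function f^{α/μ}(q) = Σ_T q^{maj(T)} over skew standard Young tableaux T of shape α/μ. -/

import Mathlib

open Finset

namespace QT

/-- The major index of a permutation of `Fin n` (sum of descents,
with positions written `1,...,n-1` as in one-line notation). -/
def maj {n : ℕ} (π : Equiv.Perm (Fin n)) : ℕ :=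
  ∑ i ∈ Finset.range n,
    if h : i + 1 < n then
      (if π ⟨i + 1, h⟩ < π ⟨i, by omega⟩ then i + 1 else 0)
    else 0

/-- `imaj π = maj π⁻¹`. -/
def imaj {n : ℕ} (π : Equiv.Perm (Fin n)) : ℕ := maj π⁻¹

/-- The permutation of `Fin k` order-isomorphic to the word `v 0, v 1, ..., v (k-1)`. -/
noncomputable def standardize {n k : ℕ} (v : Fin k → Fin n) (hv : Function.Injective v) :
    Equiv.Perm (Fin k) :=
  Equiv.ofBijective
    (fun i => (Finset.orderIsoOfFin (Finset.image v Finset.univ)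
        (by rw [Finset.card_image_of_injective _ hv, Finset.card_univ, Fintype.card_fin])).symm
        ⟨v i, Finset.mem_image_of_mem v (Finset.mem_univ i)⟩)
    (Finite.injective_iff_bijective.mp (fun i j hij => by
      have h2 := (Finset.orderIsoOfFin _ _).symm.injective hij
      exact hv (congrArg Subtype.val h2)))

/-- `π^{≤k}` : the permutation of `Fin k` order-isomorphic to the first `k` letters of `π`. -/
noncomputable def pInit {n : ℕ} (π : Equiv.Perm (Fin n)) (k : ℕ) (hk : k ≤ n) :
    Equiv.Perm (Fin k) :=
  standardize (fun i => π (Fin.castLE hk i))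
    (fun i j h => Fin.castLE_injective hk (π.injective h))

/-- `π^{>k}` : the permutation of `Fin (n-k)` order-isomorphic to the last `n - k` letters of `π`. -/
noncomputable def pTail {n : ℕ} (π : Equiv.Perm (Fin n)) (k : ℕ) :
    Equiv.Perm (Fin (n - k)) :=
  standardize (fun i => π ⟨k + (i : ℕ), by have := i.isLt; omega⟩)
    (fun i j h => by
      have h2 : k + (i : ℕ) = k + (j : ℕ) := congrArg Fin.val (π.injective h)
      exact Fin.ext (by omega))

/-- `π_{≤k}` : the permutation of `Fin k` order-isomorphic to the subword of `π`
consisting of the `k` smallest values.  (Equivalently `((π⁻¹)^{≤k})⁻¹`.) -/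
noncomputable def vLow {n : ℕ} (π : Equiv.Perm (Fin n)) (k : ℕ) (hk : k ≤ n) :
    Equiv.Perm (Fin k) := (pInit π⁻¹ k hk)⁻¹

/-- `π_{>k}` : the permutation of `Fin (n-k)` order-isomorphic to the subword of `π`
consisting of the values `> k`.  (Equivalently `((π⁻¹)^{>k})⁻¹`.) -/
noncomputable def vHigh {n : ℕ} (π : Equiv.Perm (Fin n)) (k : ℕ) :
    Equiv.Perm (Fin (n - k)) := (pTail π⁻¹ k)⁻¹

/-- The set `I_n` of involutions in `S_n`. -/
def involutions (n : ℕ) : Finset (Equiv.Perm (Fin n)) :=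
  Finset.univ.filter fun π => π * π = 1

-- `I_n(σ) = {π ∈ I_n : π_{≤m} = σ}`.
open scoped Classical in
noncomputable def involutionsC (n : ℕ) {m : ℕ} (σ : Equiv.Perm (Fin m)) :
    Finset (Equiv.Perm (Fin n)) :=
  (involutions n).filter fun π => ∃ h : m ≤ n, vLow π m h = σ

-- `S_n(σ,τ) = {π ∈ S_n : π_{≤a} = σ, π^{≤b} = τ}`.
open scoped Classical in
noncomputable def permsC (n : ℕ) {a b : ℕ} (σ : Equiv.Perm (Fin a)) (τ : Equiv.Perm (Fin b)) :
    Finset (Equiv.Perm (Fin n)) :=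
  Finset.univ.filter fun π => ∃ (ha : a ≤ n) (hb : b ≤ n), vLow π a ha = σ ∧ pInit π b hb = τ

-- The j-set `J(σ) = {j : σ^{≤j} is an involution}`.
open scoped Classical in
noncomputable def jSet {m : ℕ} (σ : Equiv.Perm (Fin m)) : Finset ℕ :=
  (Finset.range (m + 1)).filter fun j => ∃ h : j ≤ m, pInit σ j h * pInit σ j h = 1

-- The j₂-set `J(σ,τ) = {j : σ^{≤j} = τ_{≤j}}`.
open scoped Classical in
noncomputable def j2Set {a b : ℕ} (σ : Equiv.Perm (Fin a)) (τ : Equiv.Perm (Fin b)) :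
    Finset ℕ :=
  (Finset.range (min a b + 1)).filter fun j =>
    ∃ (ha : j ≤ a) (hb : j ≤ b), pInit σ j ha = vLow τ j hb

/-- A set of nonnegative integers is a j₂-set if it is `J(σ,τ)` for some pair of
permutations. -/
def IsJ2Set (S : Finset ℕ) : Prop :=
  ∃ (a b : ℕ) (σ : Equiv.Perm (Fin a)) (τ : Equiv.Perm (Fin b)), S = j2Set σ τ

-- The number of j₂-sets with largest element `n`.
open scoped Classical in
noncomputable def j2count (n : ℕ) : ℕ :=
  ((Finset.range (n + 1)).powerset.filter
    fun S => IsJ2Set S ∧ n ∈ S ∧ ∀ x ∈ S, x ≤ n).card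

/-- `[n]_q = 1 + q + ⋯ + q^{n-1}`. -/
def qInt (q : ℝ) (n : ℕ) : ℝ := ∑ i ∈ Finset.range n, q ^ i

/-- The q-factorial `[n]_q! = ∏_{i=1}^n (1 + q + ⋯ + q^{i-1})`. -/
def qFact (q : ℝ) (n : ℕ) : ℝ := ∏ i ∈ Finset.range n, qInt q (i + 1)

/-- The Gaussian binomial coefficient `[n choose k]_q = [n]_q!/([k]_q! [n-k]_q!)`,
defined via the q-Pascal recursion. -/
def qBinom (q : ℝ) : ℕ → ℕ → ℝ
  | _, 0 => 1
  | 0, _ + 1 => 0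
  | n + 1, k + 1 => qBinom q n k + q ^ (k + 1) * qBinom q n (k + 1)

/-- `t_n(q) = Σ_{π ∈ I_n} q^{maj π}`. -/
noncomputable def tq (q : ℝ) (n : ℕ) : ℝ := ∑ π ∈ involutions n, q ^ maj π

/-- `A_n(p,q) = Σ_{π ∈ S_n} p^{imaj π} q^{maj π}`. -/
noncomputable def Apq (p q : ℝ) (n : ℕ) : ℝ :=
  ∑ π : Equiv.Perm (Fin n), p ^ imaj π * q ^ maj π



/-- The `k × k` square Young diagram. -/
def square (k : ℕ) : YoungDiagram :=
  ⟨Finset.range k ×ˢ Finset.range k, by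
    intro a b hab ha
    rw [Finset.mem_coe, Finset.mem_product] at ha ⊢
    simp only [Finset.mem_range] at ha ⊢
    exact ⟨lt_of_le_of_lt hab.1 ha.1, lt_of_le_of_lt hab.2 ha.2⟩⟩

-- All Young diagrams contained in `l`.
open scoped Classical in
noncomputable def subDiagrams (l : YoungDiagram) : Finset YoungDiagram :=
  (l.cells.powerset.filter fun (s : Finset (ℕ × ℕ)) => IsLowerSet ((s : Set (ℕ × ℕ)))).attach.image
    fun s => YoungDiagram.mk s.1 (by
      have hs := s.2
      rw [Finset.mem_filter] at hs
      exact hs.2)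

/-- All Young diagrams with `k` cells (i.e. partitions of `k`). -/
noncomputable def diagramsOfCard (k : ℕ) : Finset YoungDiagram :=
  (subDiagrams (square k)).filter fun d => d.card = k

/-- A chain of Young diagrams each obtained from the previous by adding one cell.
Such chains of length `n` starting at `μ` and ending at `λ` are exactly the skew standard
Young tableaux of shape `λ/μ` with `n` cells. -/
def IsSYTChain {n : ℕ} (c : Fin (n + 1) → YoungDiagram) : Prop :=
  ∀ i : ℕ, ∀ _h : i < n,
    c ⟨i, by omega⟩ ≤ c ⟨i + 1, by omega⟩ ∧
      (c ⟨i + 1, by omega⟩).card = (c ⟨i, by omega⟩).card + 1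

-- The (skew) standard Young tableaux of shape `λ/μ` and size `n`, encoded as chains.
open scoped Classical in
noncomputable def skewSYT (mu lam : YoungDiagram) (n : ℕ) :
    Finset (Fin (n + 1) → YoungDiagram) :=
  (Fintype.piFinset fun _ : Fin (n + 1) => subDiagrams lam).filter
    fun c => c 0 = mu ∧ c (Fin.last n) = lam ∧ IsSYTChain c

-- `T_n` : all standard Young tableaux of size `n` (encoded as chains starting at `⊥`).
open scoped Classical in
noncomputable def allSYT (n : ℕ) : Finset (Fin (n + 1) → YoungDiagram) :=
  (Fintype.piFinset fun _ : Fin (n + 1) => subDiagrams (square n)).filter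
    fun c => c 0 = ⊥ ∧ IsSYTChain c

/-- The row in which the `(i+1)`-st cell of the chain `c` is added. -/
def rowOfStep {n : ℕ} (c : Fin (n + 1) → YoungDiagram) (i : ℕ) : ℕ :=
  if h : i < n then
    ((c ⟨i + 1, by omega⟩).cells \ (c ⟨i, by omega⟩).cells).sup Prod.fst
  else 0

/-- The major index of a (skew) standard Young tableau, encoded as a chain:
the sum of all `i` such that `i+1` lies in a lower row than `i`. -/
def chainMaj {n : ℕ} (c : Fin (n + 1) → YoungDiagram) : ℕ :=
  ∑ i ∈ Finset.range n,
    if i + 1 < n ∧ rowOfStep c i < rowOfStep c (i + 1) then i + 1 else 0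

/-- `f^{λ/μ}(q) = Σ_{sh(T) = λ/μ} q^{maj T}`, where `n` is the number of cells of `λ/μ`. -/
noncomputable def fSkew (mu lam : YoungDiagram) (n : ℕ) (q : ℝ) : ℝ :=
  ∑ c ∈ skewSYT mu lam n, q ^ chainMaj c

/-- `T_{>m}` : the skew tableau obtained from `T` by removing the entries `≤ m`. -/
def tailChain {n : ℕ} (c : Fin (n + 1) → YoungDiagram) (m : ℕ) :
    Fin (n - m + 1) → YoungDiagram :=
  fun i => c ⟨min (m + (i : ℕ)) n, by omega⟩

/-- `T` contains `A`, i.e. `T_{≤a} = A`. -/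
def containsT {n a : ℕ} (T : Fin (n + 1) → YoungDiagram)
    (A : Fin (a + 1) → YoungDiagram) : Prop :=
  ∀ i : Fin (a + 1), T ⟨min (i : ℕ) n, by omega⟩ = A i

-- `T_n(A,B)` : pairs of standard Young tableaux of the same shape, of size `n`,
-- containing `A` and `B` respectively.
open scoped Classical in
noncomputable def pairSYT (n : ℕ) {a b : ℕ} (A : Fin (a + 1) → YoungDiagram)
    (B : Fin (b + 1) → YoungDiagram) :
    Finset ((Fin (n + 1) → YoungDiagram) × (Fin (n + 1) → YoungDiagram)) :=
  ((allSYT n) ×ˢ (allSYT n)).filter fun PQ =>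
    PQ.1 (Fin.last n) = PQ.2 (Fin.last n) ∧ containsT PQ.1 A ∧ containsT PQ.2 B

/-- The empty standard Young tableau. -/
def emptySYT : Fin (0 + 1) → YoungDiagram := fun _ => ⊥

/-- Schensted row insertion: insert `x` into the row `r`, returning the new row and
the bumped entry (if any). -/
def insertRow : List ℕ → ℕ → List ℕ × Option ℕ
  | [], x => ([x], none)
  | y :: ys, x =>
    if x < y then (x :: ys, some y)
    else
      let p := insertRow ys x
      (y :: p.1, p.2)

/-- Schensted insertion of `x` into a tableau given as a list of rows. -/
def insertTab : List (List ℕ) → ℕ → List (List ℕ)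
  | [], x => [[x]]
  | r :: rs, x =>
    match insertRow r x with
    | (r', none) => r' :: rs
    | (r', some y) => r' :: insertTab rs y

/-- The Robinson–Schensted insertion tableau of a word. -/
def Ptab (w : List ℕ) : List (List ℕ) := w.foldl insertTab []

/-- The Young diagram with row lengths `r` (junk-robust version). -/
def diagramOfRows (r : List ℕ) : YoungDiagram :=
  ⟨(Finset.range r.length ×ˢ Finset.range (r.foldr max 0)).filter
      (fun p => ∀ i ≤ p.1, p.2 < r.getD i 0), by
    intro a b hab ha
    rw [Finset.mem_coe, Finset.mem_filter, Finset.mem_product] at ha ⊢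
    obtain ⟨⟨h1, h2⟩, h3⟩ := ha
    simp only [Finset.mem_range] at h1 h2 ⊢
    refine ⟨⟨lt_of_le_of_lt hab.1 h1, lt_of_le_of_lt hab.2 h2⟩, fun i hi => ?_⟩
    exact lt_of_le_of_lt hab.2 (h3 i (le_trans hi hab.1))⟩

/-- The shape of the Robinson–Schensted insertion tableau of a word. -/
def RSshape (w : List ℕ) : YoungDiagram := diagramOfRows ((Ptab w).map List.length)

/-- The one-line word of a permutation of `Fin a` (with values `0,…,a-1`). -/
def wordOf {a : ℕ} (σ : Equiv.Perm (Fin a)) : List ℕ :=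
  (List.finRange a).map fun i => (σ i : ℕ)

/-- The chain encoding of the Robinson–Schensted insertion tableau `P(σ)`:
its `i`-th diagram is the shape of the subtableau of `P(σ)` with entries `≤ i`,
which equals the RS-shape of the subword of `σ` with values `≤ i`. -/
def Pchain {a : ℕ} (σ : Equiv.Perm (Fin a)) : Fin (a + 1) → YoungDiagram :=
  fun i => RSshape ((wordOf σ).filter fun x => x < (i : ℕ))

/-- The chain encoding of the Robinson–Schensted recording tableau `Q(σ)`:
its `i`-th diagram is the shape of the subtableau of `Q(σ)` with entries `≤ i`,
which equals the RS-shape of the prefix of `σ` of length `i`. -/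
def Qchain {a : ℕ} (σ : Equiv.Perm (Fin a)) : Fin (a + 1) → YoungDiagram :=
  fun i => RSshape ((wordOf σ).take (i : ℕ))

theorem multiset_ne_cons (r : ℕ) (l : Multiset ℕ) : l ≠ r ::ₘ l := fun h => by
  have := congrArg Multiset.card h
  simp at this

/-- Partitions, encoded by the multiset in which `r` occurs as often as the `r`-th row is long. -/
def IsPart (l : Multiset ℕ) : Prop := ∀ r, l.count (r + 1) ≤ l.count r

/-- `m` is obtained from `l` by adding at most one cell. -/
def WeakStep (l m : Multiset ℕ) : Prop := m = l ∨ ∃ r, m = r ::ₘ l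

/-- Fomin's local rule for a unit square of a growth diagram; `p` says that the square
is marked. -/
def LocalRule (p : Prop) (l m n k : Multiset ℕ) : Prop :=
  (p ∧ m = l ∧ n = l ∧ k = 0 ::ₘ l) ∨
  (¬ p ∧ ((m = l ∧ k = n) ∨ (n = l ∧ k = m) ∨
    (∃ r s, r ≠ s ∧ m = r ::ₘ l ∧ n = s ::ₘ l ∧ k = r ::ₘ s ::ₘ l) ∨
    ∃ r, m = r ::ₘ l ∧ n = r ::ₘ l ∧ k = (r + 1) ::ₘ r ::ₘ l))

namespace LocalRule

variable {p p' : Prop} {l l' m n k k' : Multiset ℕ}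

theorem symm (h : LocalRule p l m n k) : LocalRule p l n m k := by
  rcases h with ⟨hp, h1, h2, h3⟩ | ⟨hp, h | h | ⟨r, s, hrs, h1, h2, h3⟩ | ⟨r, h1, h2, h3⟩⟩
  · exact Or.inl ⟨hp, h2, h1, h3⟩
  · exact Or.inr ⟨hp, Or.inr (Or.inl h)⟩
  · exact Or.inr ⟨hp, Or.inl h⟩
  · exact Or.inr ⟨hp, Or.inr (Or.inr (Or.inl
      ⟨s, r, hrs.symm, h2, h1, h3.trans (Multiset.cons_swap _ _ _)⟩))⟩
  · exact Or.inr ⟨hp, Or.inr (Or.inr (Or.inr ⟨r, h2, h1, h3⟩))⟩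

theorem congr (h : LocalRule p l m n k) (hp : p ↔ p') : LocalRule p' l m n k := by
  rwa [LocalRule, ← hp]

theorem forward_unique (h : LocalRule p l m n k) (h' : LocalRule p l m n k') : k = k' := by
  rcases h with ⟨hp, h1, h2, h3⟩ | ⟨hp, ⟨h1, h3⟩ | ⟨h2, h3⟩ | ⟨r, s, hrs, h1, h2, h3⟩ |
    ⟨r, h1, h2, h3⟩⟩ <;>
  rcases h' with ⟨hp', h1', h2', h3'⟩ | ⟨hp', ⟨h1', h3'⟩ | ⟨h2', h3'⟩ |
    ⟨r', s', hrs', h1', h2', h3'⟩ | ⟨r', h1', h2', h3'⟩⟩ <;>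
  subst_vars <;> simp_all [multiset_ne_cons, Multiset.cons_inj_left]

theorem backward_unique (h : LocalRule p l m n k) (h' : LocalRule p' l' m n k) :
    l = l' ∧ (p ↔ p') := by
  rcases h with ⟨hp, h1, h2, h3⟩ | ⟨hp, ⟨h1, h3⟩ | ⟨h2, h3⟩ | ⟨r, s, hrs, h1, h2, h3⟩ |
    ⟨r, h1, h2, h3⟩⟩ <;>
  rcases h' with ⟨hp', h1', h2', h3'⟩ | ⟨hp', ⟨h1', h3'⟩ | ⟨h2', h3'⟩ |
    ⟨r', s', hrs', h1', h2', h3'⟩ | ⟨r', h1', h2', h3'⟩⟩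
  case inr.inr.inr.inl.inr.inr.inr.inl =>
    rw [← h2] at h3
    rw [← h2', h3, Multiset.cons_inj_left] at h3'
    subst h3'
    exact ⟨(Multiset.cons_inj_right r).1 (h1.symm.trans h1'), by simp [hp, hp']⟩
  case inr.inr.inr.inl.inr.inr.inr.inr =>
    have hmn : m = n := h1'.trans h2'.symm
    rw [h1, h2, Multiset.cons_inj_left] at hmn
    exact absurd hmn hrs
  case inr.inr.inr.inr.inr.inr.inr.inr =>
    rw [← h2] at h3
    rw [← h2', h3, Multiset.cons_inj_left, add_left_inj] at h3'
    subst h3'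
    exact ⟨(Multiset.cons_inj_right r).1 (h1.symm.trans h1'), by simp [hp, hp']⟩
  all_goals
    subst_vars
    simp_all [multiset_ne_cons, Multiset.cons_eq_cons]

theorem isPart (h : LocalRule p l m n k) (hl : IsPart l) (hm : IsPart m) (hn : IsPart n) :
    IsPart k := by
  rcases h with ⟨hp, h1, h2, rfl⟩ | ⟨hp, ⟨h1, h3⟩ | ⟨h2, h3⟩ | ⟨r, s, hrs, rfl, rfl, rfl⟩ |
    ⟨r, rfl, rfl, rfl⟩⟩
  · intro t
    have := hl t
    simp only [Multiset.count_cons]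
    grind
  · rwa [h3]
  · rwa [h3]
  · intro t
    have := hl t
    have := hm t
    have := hn t
    simp only [Multiset.count_cons] at *
    grind
  · intro t
    have := hl t
    have := hm t
    simp only [Multiset.count_cons] at *
    grind

end LocalRule

theorem exists_localRule {m n k : Multiset ℕ} (hm : IsPart m) (hn : IsPart n) (hk : IsPart k)
    (hmk : WeakStep m k) (hnk : WeakStep n k) :
    ∃ (p : Prop) (l : Multiset ℕ), LocalRule p l m n k ∧ IsPart l ∧ WeakStep l m ∧
      WeakStep l n := by
  rcases hmk with rfl | ⟨r, rfl⟩
  · exact ⟨False, n, Or.inr ⟨id, Or.inr (Or.inl ⟨rfl, rfl⟩)⟩, hn, hnk, Or.inl rfl⟩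
  rcases hnk with rfl | ⟨s, h⟩
  · exact ⟨False, m, Or.inr ⟨id, Or.inl ⟨rfl, rfl⟩⟩, hm, Or.inl rfl, Or.inr ⟨r, rfl⟩⟩
  rcases Multiset.cons_eq_cons.1 h with ⟨rfl, rfl⟩ | ⟨hrs, l, rfl, rfl⟩
  · cases r with
    | zero => exact ⟨True, m, Or.inl ⟨trivial, rfl, rfl, rfl⟩, hm, Or.inl rfl, Or.inl rfl⟩
    | succ r =>
      have hr : r ∈ m := by
        rw [← Multiset.count_pos]
        have := hk r
        simp only [Multiset.count_cons] at this
        grind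
      obtain ⟨l, rfl⟩ := Multiset.exists_cons_of_mem hr
      refine ⟨False, l, Or.inr ⟨id, Or.inr (Or.inr (Or.inr ⟨r, rfl, rfl, rfl⟩))⟩, ?_,
        Or.inr ⟨r, rfl⟩, Or.inr ⟨r, rfl⟩⟩
      intro t
      have := hm t
      have := hk t
      simp only [Multiset.count_cons] at *
      grind
  · refine ⟨False, l, Or.inr ⟨id, Or.inr (Or.inr (Or.inl
      ⟨s, r, Ne.symm hrs, rfl, rfl, Multiset.cons_swap _ _ _⟩))⟩, ?_,
        Or.inr ⟨s, rfl⟩, Or.inr ⟨r, rfl⟩⟩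
    intro t
    have := hm t
    have := hn t
    have := hk t
    simp only [Multiset.count_cons] at *
    grind

/-- The array `B` obeys the local rules in the rows from `j` to `a` and the columns from
`0` to `b`, with marked squares `M`. -/
def IsGrowth (M : ℕ → ℕ → Prop) (B : ℕ → ℕ → Multiset ℕ) (j a b : ℕ) : Prop :=
  ∀ i k, j ≤ i → i < a → k < b →
    LocalRule (M i k) (B i k) (B (i + 1) k) (B i (k + 1)) (B (i + 1) (k + 1))

namespace IsGrowth

variable {M M' : ℕ → ℕ → Prop} {B B' : ℕ → ℕ → Multiset ℕ} {j a b : ℕ}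

theorem mono (h : IsGrowth M B j a b) {j' a' b' : ℕ} (hj : j ≤ j') (ha : a' ≤ a) (hb : b' ≤ b) :
    IsGrowth M B j' a' b' := fun i k h1 h2 h3 =>
  h i k (hj.trans h1) (h2.trans_le ha) (h3.trans_le hb)

theorem transpose (h : IsGrowth M B 0 a b) :
    IsGrowth (fun i k => M k i) (fun i k => B k i) 0 b a := fun i k _ h2 h3 =>
  (h k i (Nat.zero_le _) h3 h2).symm

theorem eq_of_forward (h : IsGrowth M B 0 a b) (h' : IsGrowth M B' 0 a b)
    (hrow : ∀ k ≤ b, B 0 k = B' 0 k) (hcol : ∀ i ≤ a, B i 0 = B' i 0) :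
    ∀ i ≤ a, ∀ k ≤ b, B i k = B' i k := by
  intro i
  induction i with
  | zero => exact fun _ => hrow
  | succ i ihi =>
    intro hi k
    induction k with
    | zero => exact fun _ => hcol _ hi
    | succ k ihk =>
      intro hk
      have h1 := h i k (Nat.zero_le _) hi hk
      have h2 := h' i k (Nat.zero_le _) hi hk
      rw [← ihi (by omega) k (by omega), ← ihi (by omega) (k + 1) hk, ← ihk (by omega)] at h2
      exact h1.forward_unique h2

theorem backward_unique (h : IsGrowth M B j a b) (h' : IsGrowth M' B' j a b)
    (hrow : ∀ k ≤ b, B a k = B' a k) (hcol : ∀ i, j ≤ i → i ≤ a → B i b = B' i b) :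
    (∀ i, j ≤ i → i ≤ a → ∀ k ≤ b, B i k = B' i k) ∧
      ∀ i, j ≤ i → i < a → ∀ k < b, (M i k ↔ M' i k) := by
  have key : ∀ i, j ≤ i → i ≤ a → ∀ k ≤ b, B i k = B' i k := by
    intro i hji hia
    induction hia using Nat.decreasingInduction with
    | self => exact hrow
    | of_succ i hi ihi =>
      intro k hk
      induction hk using Nat.decreasingInduction with
      | self => exact hcol _ hji (by omega)
      | of_succ k hk ihk =>
        have h1 := h i k hji hi hk
        have h2 := h' i k hji hi hk
        rw [← ihi (by omega) k (by omega), ← ihi (by omega) (k + 1) hk, ← ihk] at h2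
        exact (h1.backward_unique h2).1
  refine ⟨key, fun i hji hi k hk => ?_⟩
  have h1 := h i k hji hi hk
  have h2 := h' i k hji hi hk
  rw [← key i hji (by omega) (k + 1) hk, ← key (i + 1) (by omega) hi (k + 1) hk,
    ← key (i + 1) (by omega) hi k (by omega)] at h2
  exact (h1.backward_unique h2).2

theorem isPart (h : IsGrowth M B 0 a b) (hrow : ∀ k ≤ b, IsPart (B 0 k))
    (hcol : ∀ i ≤ a, IsPart (B i 0)) : ∀ i ≤ a, ∀ k ≤ b, IsPart (B i k) := by
  intro i
  induction i with
  | zero => exact fun _ => hrow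
  | succ i ihi =>
    intro hi k
    induction k with
    | zero => exact fun _ => hcol _ hi
    | succ k ihk =>
      intro hk
      exact (h i k (Nat.zero_le _) hi hk).isPart (ihi (by omega) k (by omega)) (ihk (by omega))
        (ihi (by omega) (k + 1) hk)

end IsGrowth

theorem exists_growth_row (C : ℕ → Multiset ℕ) (b : ℕ) (hC : ∀ k < b, WeakStep (C k) (C (k + 1)))
    (hP : ∀ k ≤ b, IsPart (C k)) (m : Multiset ℕ) (hm : IsPart m) (hmC : WeakStep m (C b)) :
    ∃ (M : ℕ → Prop) (D : ℕ → Multiset ℕ), D b = m ∧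
      (∀ k < b, LocalRule (M k) (D k) (C k) (D (k + 1)) (C (k + 1))) ∧
      (∀ k ≤ b, IsPart (D k)) ∧ (∀ k < b, WeakStep (D k) (D (k + 1))) ∧
      WeakStep (D 0) (C 0) := by
  induction b generalizing m with
  | zero => exact ⟨fun _ => True, fun _ => m, rfl, by simp, by simpa using hm, by simp, hmC⟩
  | succ b ih =>
    obtain ⟨p, l, hr, hl, hlm, hln⟩ := exists_localRule (hP b (by omega)) hm (hP (b + 1) le_rfl)
      (hC b (by omega)) hmC
    obtain ⟨M, D, hD, hM, hDP, hDs, hD0⟩ := ih (fun k hk => hC k (by omega))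
      (fun k hk => hP k (by omega)) l hl hlm
    refine ⟨fun k => if k < b then M k else p, fun k => if k ≤ b then D k else m, by simp,
      ?_, ?_, ?_, by simpa using hD0⟩
    · intro k hk
      rcases Nat.lt_succ_iff_lt_or_eq.1 hk with hk | rfl
      · simpa [hk, hk.le, Nat.succ_le_iff] using hM k hk
      · simpa [hD] using hr
    · intro k hk
      by_cases h : k ≤ b
      · simpa [h] using hDP k h
      · simpa [h] using hm
    · intro k hk
      rcases Nat.lt_succ_iff_lt_or_eq.1 hk with hk | rfl
      · simpa [hk, hk.le, Nat.succ_le_iff] using hDs k hk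
      · simpa [hD] using hln

theorem exists_growth (a b : ℕ) (C Q : ℕ → Multiset ℕ)
    (hC : ∀ k < b, WeakStep (C k) (C (k + 1))) (hP : ∀ k ≤ b, IsPart (C k))
    (hQ : ∀ i < a, WeakStep (Q i) (Q (i + 1))) (hQP : ∀ i ≤ a, IsPart (Q i)) (hCQ : C b = Q a) :
    ∃ (M : ℕ → ℕ → Prop) (B : ℕ → ℕ → Multiset ℕ), IsGrowth M B 0 a b ∧
      (∀ k ≤ b, B a k = C k) ∧ (∀ i ≤ a, B i b = Q i) ∧ (∀ k ≤ b, IsPart (B 0 k)) ∧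
      (∀ k < b, WeakStep (B 0 k) (B 0 (k + 1))) ∧ (∀ i < a, WeakStep (B i 0) (B (i + 1) 0)) := by
  induction a generalizing C with
  | zero =>
    refine ⟨fun _ _ => True, fun _ => C, fun i k _ h => absurd h (by omega), fun _ _ => rfl, ?_,
      hP, hC, fun i h => absurd h (by omega)⟩
    intro i hi
    obtain rfl : i = 0 := by omega
    exact hCQ
  | succ a ih =>
    obtain ⟨N, D, hD, hN, hDP, hDs, hD0⟩ := exists_growth_row C b hC hP (Q a) (hQP a (by omega))
      (hCQ ▸ hQ a (by omega))
    obtain ⟨M, B, hB, hrow, hcol, hBP, hBs, hB0⟩ := ih D hDs hDP (fun i hi => hQ i (by omega))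
      (fun i hi => hQP i (by omega)) hD
    refine ⟨fun i k => if i < a then M i k else N k, fun i k => if i ≤ a then B i k else C k,
      ?_, by simp, ?_, by simpa using hBP, by simpa using hBs, ?_⟩
    · intro i k _ hi hk
      rcases Nat.lt_succ_iff_lt_or_eq.1 hi with hi | rfl
      · simpa [hi, hi.le, Nat.succ_le_iff] using hB i k (Nat.zero_le _) hi hk
      · simpa [hrow k hk.le, hrow (k + 1) hk] using hN k hk
    · intro i hi
      by_cases h : i ≤ a
      · simpa [h] using hcol i h
      · obtain rfl : i = a + 1 := by omega
        simpa using hCQ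
    · intro i hi
      rcases Nat.lt_succ_iff_lt_or_eq.1 hi with hi | rfl
      · simpa [hi, hi.le, Nat.succ_le_iff] using hB0 i hi
      · simpa [hrow 0 (Nat.zero_le _)] using hD0

/-- The multiset in which `r` occurs as often as the `r`-th row is long. -/
def rowMultiset : List (List ℕ) → Multiset ℕ
  | [] => 0
  | R :: Rs => Multiset.replicate R.length 0 + (rowMultiset Rs).map Nat.succ

/-- `AppendsAt k T T' r` says that `T'` arises from `T` by appending `k` to the `r`-th row. -/
inductive AppendsAt (k : ℕ) : List (List ℕ) → List (List ℕ) → ℕ → Prop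
  | new : AppendsAt k [] [[k]] 0
  | here (R : List ℕ) (Rs : List (List ℕ)) : AppendsAt k (R :: Rs) ((R ++ [k]) :: Rs) 0
  | there (R : List ℕ) {Rs Rs' : List (List ℕ)} {r : ℕ} (h : AppendsAt k Rs Rs' r) :
      AppendsAt k (R :: Rs) (R :: Rs') (r + 1)

theorem AppendsAt.rowMultiset_eq {k r : ℕ} {T T' : List (List ℕ)} (h : AppendsAt k T T' r) :
    rowMultiset T' = r ::ₘ rowMultiset T := by
  induction h with
  | new => rfl
  | here R Rs => simp [rowMultiset, Multiset.replicate_succ]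
  | there R h ih => simp [rowMultiset, ih]

/-- Every entry of `T` is smaller than `k`. -/
def EntriesLT (k : ℕ) (T : List (List ℕ)) : Prop := ∀ R ∈ T, ∀ y ∈ R, y < k

theorem insertRow_none {R R' : List ℕ} {x : ℕ} (h : insertRow R x = (R', none)) :
    R' = R ++ [x] := by
  induction R generalizing R' with
  | nil => simpa [insertRow] using h.symm
  | cons y ys ih =>
    rw [insertRow] at h
    split_ifs at h with hxy
    · simp at h
    · simp only [Prod.mk.injEq] at h
      rw [← h.1, List.cons_append, ← ih (Prod.ext rfl h.2)]

theorem insertRow_some {R R' : List ℕ} {x y : ℕ} (h : insertRow R x = (R', some y)) :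
    y ∈ R ∧ R'.length = R.length ∧ ∀ z ∈ R', z ∈ R ∨ z = x := by
  induction R generalizing R' with
  | nil => simp [insertRow] at h
  | cons w ws ih =>
    rw [insertRow] at h
    split_ifs at h with hxy
    · simp only [Prod.mk.injEq, Option.some.injEq] at h
      obtain ⟨rfl, rfl⟩ := h
      simp
      tauto
    · simp only [Prod.mk.injEq] at h
      obtain ⟨h1, h2, h3⟩ := ih (Prod.ext rfl h.2)
      rw [← h.1]
      simp only [List.mem_cons, List.length_cons, h2]
      grind

theorem insertRow_append_none {R R' : List ℕ} {x k : ℕ} (hxk : x < k)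
    (h : insertRow R x = (R', none)) : insertRow (R ++ [k]) x = (R ++ [x], some k) := by
  induction R generalizing R' with
  | nil => simp [insertRow, hxk]
  | cons y ys ih =>
    rw [insertRow] at h
    split_ifs at h with hxy
    · simp at h
    · simp only [Prod.mk.injEq] at h
      simp [insertRow, hxy, ih (Prod.ext rfl h.2)]

theorem insertRow_append_some {R R' : List ℕ} {x y : ℕ} (k : ℕ)
    (h : insertRow R x = (R', some y)) : insertRow (R ++ [k]) x = (R' ++ [k], some y) := by
  induction R generalizing R' with
  | nil => simp [insertRow] at h
  | cons w ws ih =>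
    rw [insertRow] at h
    split_ifs at h with hxy
    · simp only [Prod.mk.injEq, Option.some.injEq] at h
      obtain ⟨rfl, rfl⟩ := h
      simp [insertRow, hxy]
    · simp only [Prod.mk.injEq] at h
      simp [insertRow, hxy, ih (Prod.ext rfl h.2), ← h.1]

theorem insertRow_of_lt {R : List ℕ} {k : ℕ} (h : ∀ y ∈ R, y < k) :
    insertRow R k = (R ++ [k], none) := by
  induction R with
  | nil => rfl
  | cons y ys ih =>
    have := h y (by simp)
    simp [insertRow, ih fun z hz => h z (by simp [hz]), this.le]

theorem insertTab_of_none {R R' : List ℕ} {Rs : List (List ℕ)} {x : ℕ}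
    (h : insertRow R x = (R', none)) : insertTab (R :: Rs) x = R' :: Rs := by
  rw [insertTab, h]

theorem insertTab_of_some {R R' : List ℕ} {Rs : List (List ℕ)} {x y : ℕ}
    (h : insertRow R x = (R', some y)) : insertTab (R :: Rs) x = R' :: insertTab Rs y := by
  rw [insertTab, h]

theorem EntriesLT.insertTab {k x : ℕ} {T : List (List ℕ)} (hT : EntriesLT k T) (hx : x < k) :
    EntriesLT k (insertTab T x) := by
  induction T generalizing x with
  | nil => simpa [QT.insertTab, EntriesLT] using hx
  | cons R Rs ih =>
    simp only [EntriesLT, List.forall_mem_cons] at hT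
    obtain ⟨R', _ | y, h⟩ : ∃ R' o, insertRow R x = (R', o) := ⟨_, _, rfl⟩
    · rw [insertTab_of_none h, insertRow_none h]
      simp only [EntriesLT, List.forall_mem_cons]
      refine ⟨?_, hT.2⟩
      simpa [or_imp, forall_and, hx] using hT.1
    · rw [insertTab_of_some h]
      obtain ⟨h1, -, h3⟩ := insertRow_some h
      simp only [EntriesLT, List.forall_mem_cons]
      refine ⟨fun z hz => ?_, ih hT.2 (hT.1 y h1)⟩
      rcases h3 z hz with h | rfl
      exacts [hT.1 z h, hx]

theorem EntriesLT.appendsAt_insertTab {k : ℕ} {T : List (List ℕ)} (hT : EntriesLT k T) :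
    AppendsAt k T (QT.insertTab T k) 0 := by
  cases T with
  | nil => exact .new
  | cons R Rs =>
    rw [insertTab_of_none (insertRow_of_lt (hT R (by simp)))]
    exact .here R Rs

theorem exists_rowMultiset_insertTab (T : List (List ℕ)) (x : ℕ) :
    ∃ s, rowMultiset (insertTab T x) = s ::ₘ rowMultiset T := by
  induction T generalizing x with
  | nil => exact ⟨0, rfl⟩
  | cons R Rs ih =>
    obtain ⟨R', _ | y, h⟩ : ∃ R' o, insertRow R x = (R', o) := ⟨_, _, rfl⟩
    · rw [insertTab_of_none h, insertRow_none h]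
      exact ⟨0, by simp [rowMultiset, Multiset.replicate_succ]⟩
    · rw [insertTab_of_some h]
      obtain ⟨s, hs⟩ := ih y
      exact ⟨s + 1, by simp [rowMultiset, (insertRow_some h).2.1, hs]⟩

theorem AppendsAt.insertTab {k x r : ℕ} {T T' : List (List ℕ)} (h : AppendsAt k T T' r)
    (hT : EntriesLT k T) (hx : x < k) :
    ∃ s, rowMultiset (insertTab T x) = s ::ₘ rowMultiset T ∧
      AppendsAt k (insertTab T x) (insertTab T' x) (if r = s then r + 1 else r) := by
  induction h generalizing x with
  | new =>
    refine ⟨0, rfl, ?_⟩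
    have : QT.insertTab [[k]] x = [[x], [k]] := by
      simp [QT.insertTab, insertRow, hx]
    rw [this]
    exact .there _ .new
  | here R Rs =>
    simp only [EntriesLT, List.forall_mem_cons] at hT
    obtain ⟨R', _ | y, h⟩ : ∃ R' o, insertRow R x = (R', o) := ⟨_, _, rfl⟩
    · rw [insertTab_of_none h, insertTab_of_some (insertRow_append_none hx h), insertRow_none h]
      exact ⟨0, by simp [rowMultiset, Multiset.replicate_succ],
        .there _ (EntriesLT.appendsAt_insertTab hT.2)⟩
    · rw [insertTab_of_some h, insertTab_of_some (insertRow_append_some k h)]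
      obtain ⟨s, hs⟩ := exists_rowMultiset_insertTab Rs y
      exact ⟨s + 1, by simp [rowMultiset, (insertRow_some h).2.1, hs], by simpa using .here _ _⟩
  | @there R Rs Rs' r h ih =>
    simp only [EntriesLT, List.forall_mem_cons] at hT
    obtain ⟨R', _ | y, h'⟩ : ∃ R' o, insertRow R x = (R', o) := ⟨_, _, rfl⟩
    · rw [insertTab_of_none h', insertTab_of_none h', insertRow_none h']
      exact ⟨0, by simp [rowMultiset, Multiset.replicate_succ], by simpa using .there _ h⟩
    · rw [insertTab_of_some h', insertTab_of_some h']
      obtain ⟨h1, h2, -⟩ := insertRow_some h'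
      obtain ⟨s, hs, hs'⟩ := ih hT.2 (hT.1 y h1)
      refine ⟨s + 1, by simp [rowMultiset, h2, hs], ?_⟩
      have := hs'.there R'
      by_cases hrs : r = s <;> simp_all

/-- The insertion tableau of the letters smaller than `k` among the first `i` letters of `f`. -/
def gridTab (f : ℕ → ℕ) (i k : ℕ) : List (List ℕ) :=
  Ptab (((List.range i).map f).filter fun x => x < k)

/-- The growth diagram of the word `f`. -/
def grid (f : ℕ → ℕ) (i k : ℕ) : Multiset ℕ := rowMultiset (gridTab f i k)

theorem gridTab_succ_of_lt {f : ℕ → ℕ} {i k : ℕ} (h : f i < k) :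
    gridTab f (i + 1) k = insertTab (gridTab f i k) (f i) := by
  simp [gridTab, Ptab, List.range_succ, h]

theorem gridTab_succ_of_le {f : ℕ → ℕ} {i k : ℕ} (h : k ≤ f i) :
    gridTab f (i + 1) k = gridTab f i k := by
  simp [gridTab, List.range_succ, h]

theorem entriesLT_gridTab (f : ℕ → ℕ) (i k : ℕ) : EntriesLT k (gridTab f i k) := by
  induction i with
  | zero => simp [gridTab, Ptab, EntriesLT]
  | succ i ih =>
    rcases lt_or_ge (f i) k with h | h
    · rw [gridTab_succ_of_lt h]
      exact ih.insertTab h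
    · rwa [gridTab_succ_of_le h]

theorem gridTab_mark {f : ℕ → ℕ} (hf : f.Injective) (i : ℕ) :
    gridTab f i (f i + 1) = gridTab f i (f i) := by
  simp only [gridTab]
  congr 1
  refine List.filter_congr fun x hx => ?_
  obtain ⟨i', hi', rfl⟩ := List.mem_map.1 hx
  have : f i' ≠ f i := fun h' => (List.mem_range.1 hi').ne (hf h')
  simp only [decide_eq_decide]
  omega

theorem appendsAt_gridTab_mark {f : ℕ → ℕ} (hf : f.Injective) (i : ℕ) :
    AppendsAt (f i) (gridTab f (i + 1) (f i)) (gridTab f (i + 1) (f i + 1)) 0 := by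
  rw [gridTab_succ_of_le le_rfl, gridTab_succ_of_lt (Nat.lt_succ_self _), gridTab_mark hf]
  exact (entriesLT_gridTab f i _).appendsAt_insertTab

theorem gridTab_column {f : ℕ → ℕ} (hf : f.Injective) (i k : ℕ) :
    gridTab f i (k + 1) = gridTab f i k ∨
      ∃ r, AppendsAt k (gridTab f i k) (gridTab f i (k + 1)) r := by
  induction i with
  | zero => exact Or.inl rfl
  | succ i ih =>
    rcases lt_trichotomy (f i) k with h | rfl | h
    · rw [gridTab_succ_of_lt h, gridTab_succ_of_lt (h.trans (Nat.lt_succ_self k))]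
      rcases ih with h2 | ⟨r, hr⟩
      · exact Or.inl (by rw [h2])
      · obtain ⟨s, -, hs⟩ := hr.insertTab (entriesLT_gridTab f i k) h
        exact Or.inr ⟨_, hs⟩
    · exact Or.inr ⟨0, appendsAt_gridTab_mark hf i⟩
    · rwa [gridTab_succ_of_le h.le, gridTab_succ_of_le h]

theorem localRule_grid {f : ℕ → ℕ} (hf : f.Injective) (i k : ℕ) :
    LocalRule (f i = k) (grid f i k) (grid f (i + 1) k) (grid f i (k + 1))
      (grid f (i + 1) (k + 1)) := by
  unfold grid
  rcases lt_trichotomy (f i) k with h | rfl | h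
  · refine Or.inr ⟨h.ne, ?_⟩
    rw [gridTab_succ_of_lt h, gridTab_succ_of_lt (h.trans (Nat.lt_succ_self k))]
    rcases gridTab_column hf i k with h2 | ⟨r, hr⟩
    · exact Or.inr (Or.inl (by simp [h2]))
    · obtain ⟨s, hs, hs'⟩ := hr.insertTab (entriesLT_gridTab f i k) h
      rw [hs'.rowMultiset_eq, hs, hr.rowMultiset_eq]
      right; right
      split_ifs with hrs
      · subst hrs
        exact Or.inr ⟨r, rfl, rfl, rfl⟩
      · exact Or.inl ⟨s, r, Ne.symm hrs, rfl, rfl, Multiset.cons_swap _ _ _⟩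
  · rw [(appendsAt_gridTab_mark hf i).rowMultiset_eq, gridTab_mark hf, gridTab_succ_of_le le_rfl]
    exact Or.inl ⟨rfl, rfl, rfl, rfl⟩
  · rw [gridTab_succ_of_le h.le, gridTab_succ_of_le h]
    exact Or.inr ⟨h.ne', Or.inl ⟨rfl, rfl⟩⟩

theorem isGrowth_grid {f : ℕ → ℕ} (hf : f.Injective) (j a b : ℕ) :
    IsGrowth (fun i k => f i = k) (grid f) j a b := fun i k _ _ _ => localRule_grid hf i k

@[simp] theorem grid_zero_left (f : ℕ → ℕ) (k : ℕ) : grid f 0 k = 0 := by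
  simp [grid, gridTab, Ptab, rowMultiset]

@[simp] theorem grid_zero_right (f : ℕ → ℕ) (i : ℕ) : grid f i 0 = 0 := by
  simp [grid, gridTab, Ptab, rowMultiset]

theorem isPart_zero : IsPart 0 := fun r => by simp

theorem isPart_grid {f : ℕ → ℕ} (hf : f.Injective) (i k : ℕ) : IsPart (grid f i k) :=
  (isGrowth_grid hf 0 i k).isPart (by simp [isPart_zero]) (by simp [isPart_zero]) i le_rfl k le_rfl

theorem card_grid (f : ℕ → ℕ) (i k : ℕ) :
    (grid f i k).card = #{i' ∈ range i | f i' < k} := by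
  induction i with
  | zero => simp
  | succ i ih =>
    rw [range_add_one, filter_insert, grid]
    split_ifs with h
    · obtain ⟨s, hs⟩ := exists_rowMultiset_insertTab (gridTab f i k) (f i)
      rw [gridTab_succ_of_lt h, hs, Multiset.card_cons, ← grid, ih,
        card_insert_of_notMem (by simp)]
    · rw [gridTab_succ_of_le (not_lt.1 h), ← grid, ih]

theorem grid_symm {f g : ℕ → ℕ} (hf : f.Injective) (hg : g.Injective) {a b : ℕ}
    (h : ∀ i < a, ∀ k < b, f i = k ↔ g k = i) : ∀ i ≤ a, ∀ k ≤ b, grid f i k = grid g k i := by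
  refine (isGrowth_grid hf 0 a b).eq_of_forward (B' := fun i k => grid g k i) ?_ (by simp) (by simp)
  intro i k _ hi hk
  exact (localRule_grid hg k i).symm.congr (h i hi k hk).symm

/-- The partition of a Young diagram, as the multiset of the row indices of its cells. -/
def cellRows (d : YoungDiagram) : Multiset ℕ := d.cells.val.map Prod.fst

@[simp] theorem card_cellRows (d : YoungDiagram) : (cellRows d).card = d.card := by
  simp [cellRows]

@[simp] theorem cellRows_bot : cellRows ⊥ = 0 := by simp [cellRows]

theorem count_cellRows (d : YoungDiagram) (r : ℕ) : (cellRows d).count r = d.rowLen r := by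
  rw [cellRows, Multiset.count_map, YoungDiagram.rowLen_eq_card, YoungDiagram.row]
  simp only [Finset.card_def, Finset.filter_val, eq_comm]

theorem isPart_cellRows (d : YoungDiagram) : IsPart (cellRows d) := fun r => by
  rw [count_cellRows, count_cellRows]
  exact d.rowLen_anti _ _ (Nat.le_succ r)

theorem cellRows_le_iff {d d' : YoungDiagram} : cellRows d ≤ cellRows d' ↔ d ≤ d' := by
  refine ⟨fun h => ?_, fun h => Multiset.map_le_map (Finset.val_le_iff.2 h)⟩
  rintro ⟨r, c⟩ hc
  have hc : (r, c) ∈ d := hc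
  change (r, c) ∈ d'
  rw [YoungDiagram.mem_iff_lt_rowLen, ← count_cellRows] at *
  exact hc.trans_le (Multiset.count_le_of_le r h)

theorem cellRows_injective : Function.Injective cellRows := fun _ _ h =>
  le_antisymm (cellRows_le_iff.1 h.le) (cellRows_le_iff.1 h.ge)

theorem cellRows_cons_of_le {d d' : YoungDiagram} (h : d ≤ d') (hc : d'.card = d.card + 1) :
    cellRows d' = (d'.cells \ d.cells).sup Prod.fst ::ₘ cellRows d := by
  have hsub : d.cells ⊆ d'.cells := h
  have h1 : #(d'.cells \ d.cells) = 1 := by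
    rw [card_sdiff_of_subset hsub]
    change d'.card - d.card = 1
    omega
  obtain ⟨x, hx⟩ := card_eq_one.1 h1
  have h2 : d'.cells = cons x d.cells (by
      have : x ∈ d'.cells \ d.cells := by simp [hx]
      exact (mem_sdiff.1 this).2) := by
    rw [cons_eq_insert, insert_eq, ← hx, sdiff_union_of_subset hsub]
  rw [hx, sup_singleton, cellRows, h2, cons_val, Multiset.map_cons, cellRows]

theorem rowOfStep_eq {n : ℕ} {c : Fin (n + 1) → YoungDiagram} {i r : ℕ} (hi : i < n)
    (h : cellRows (c ⟨i + 1, by omega⟩) = r ::ₘ cellRows (c ⟨i, by omega⟩)) :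
    rowOfStep c i = r := by
  have h1 : c ⟨i, by omega⟩ ≤ c ⟨i + 1, by omega⟩ := by
    rw [← cellRows_le_iff, h]
    exact Multiset.le_cons_self _ _
  have h2 := cellRows_cons_of_le h1 (by rw [← card_cellRows, h]; simp)
  rw [h, Multiset.cons_inj_left] at h2
  rw [rowOfStep, dif_pos hi, h2]

theorem mem_subDiagrams {d l : YoungDiagram} : d ∈ subDiagrams l ↔ d ≤ l := by
  classical
  simp only [subDiagrams, mem_image, mem_attach, true_and, Subtype.exists, mem_filter, mem_powerset]
  constructor
  · rintro ⟨s, ⟨h, -⟩, rfl⟩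
    exact h
  · exact fun h => ⟨d.cells, ⟨h, d.isLowerSet⟩, rfl⟩

theorem isSYTChain_iff {n : ℕ} {c : Fin (n + 1) → YoungDiagram} :
    IsSYTChain c ↔ ∀ i, ∀ _ : i < n, ∃ r,
      cellRows (c ⟨i + 1, by omega⟩) = r ::ₘ cellRows (c ⟨i, by omega⟩) := by
  refine forall₂_congr fun i hi => ⟨fun h => ⟨_, cellRows_cons_of_le h.1 h.2⟩, ?_⟩
  rintro ⟨r, h⟩
  rw [← cellRows_le_iff, ← card_cellRows, h]
  exact ⟨Multiset.le_cons_self _ _, by simp⟩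

theorem mem_skewSYT {mu lam : YoungDiagram} {n : ℕ} {c : Fin (n + 1) → YoungDiagram} :
    c ∈ skewSYT mu lam n ↔ c 0 = mu ∧ c (Fin.last n) = lam ∧ IsSYTChain c := by
  classical
  simp only [skewSYT, mem_filter, Fintype.mem_piFinset, mem_subDiagrams, and_iff_right_iff_imp]
  rintro ⟨-, rfl, h⟩
  have key : ∀ i (hi : i ≤ n), c ⟨i, by omega⟩ ≤ c (Fin.last n) := by
    intro i hi
    induction hi using Nat.decreasingInduction with
    | self => exact le_rfl
    | of_succ i hi ih => exact (h i hi).1.trans ih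
  exact fun i => key i (by omega)

theorem count_rowMultiset (T : List (List ℕ)) (r : ℕ) :
    (rowMultiset T).count r = (T.map List.length).getD r 0 := by
  induction T generalizing r with
  | nil => simp [rowMultiset]
  | cons R Rs ih =>
    cases r with
    | zero =>
      simp [rowMultiset]
    | succ r =>
      rw [rowMultiset, Multiset.count_add, Multiset.count_map_eq_count' _ _ Nat.succ_injective, ih]
      simp [Multiset.count_replicate]

theorem getD_le_foldr_max (l : List ℕ) (r : ℕ) : l.getD r 0 ≤ l.foldr max 0 := by
  induction l generalizing r with
  | nil => simp
  | cons x xs ih =>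
    cases r with
    | zero => simp
    | succ r => simpa using Or.inr (ih r)

theorem cellRows_diagramOfRows {T : List (List ℕ)} (h : IsPart (rowMultiset T)) :
    cellRows (diagramOfRows (T.map List.length)) = rowMultiset T := by
  have hanti : Antitone fun r => (rowMultiset T).count r := antitone_nat_of_succ_le h
  have hmem : ∀ r c, (r, c) ∈ diagramOfRows (T.map List.length) ↔
      c < (rowMultiset T).count r := by
    intro r c
    rw [← YoungDiagram.mem_cells, diagramOfRows]
    simp only [mem_filter, mem_product, mem_range, ← count_rowMultiset]
    refine ⟨fun h => h.2 r le_rfl, fun h => ⟨⟨?_, ?_⟩, fun i hi => h.trans_le (hanti hi)⟩⟩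
    · by_contra hr
      rw [count_rowMultiset, List.getD_eq_default _ _ (not_lt.1 hr)] at h
      omega
    · rw [count_rowMultiset] at h
      exact h.trans_le (getD_le_foldr_max _ _)
  ext r
  rw [count_cellRows]
  refine eq_of_forall_lt_iff fun c => ?_
  rw [← YoungDiagram.mem_iff_lt_rowLen, hmem]

/-- A permutation of `Fin a`, extended to the natural numbers by the identity. -/
def extend {a : ℕ} (σ : Equiv.Perm (Fin a)) (i : ℕ) : ℕ :=
  if h : i < a then σ ⟨i, h⟩ else i

theorem extend_of_lt {a i : ℕ} (σ : Equiv.Perm (Fin a)) (h : i < a) :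
    extend σ i = σ ⟨i, h⟩ := dif_pos h

theorem extend_lt {a i : ℕ} (σ : Equiv.Perm (Fin a)) (h : i < a) : extend σ i < a := by
  rw [extend_of_lt σ h]
  exact (σ _).2

theorem extend_injective {a : ℕ} (σ : Equiv.Perm (Fin a)) : (extend σ).Injective := by
  intro i k h
  unfold extend at h
  split_ifs at h with h1 h2 h2
  · simpa using σ.injective (Fin.ext h)
  · have := (σ ⟨i, h1⟩).2
    omega
  · have := (σ ⟨k, h2⟩).2
    omega
  · exact h

theorem perm_ext_of_extend {a : ℕ} {σ τ : Equiv.Perm (Fin a)}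
    (h : ∀ i < a, ∀ k < a, extend σ i = k ↔ extend τ i = k) : σ = τ := by
  ext i
  have := (h i i.2 (extend σ i) (extend_lt σ i.2)).1 rfl
  rw [extend_of_lt σ i.2, extend_of_lt τ i.2] at this
  exact this.symm

theorem extend_inv {a i k : ℕ} (σ : Equiv.Perm (Fin a)) (hi : i < a) (hk : k < a) :
    extend σ i = k ↔ extend σ⁻¹ k = i := by
  rw [extend_of_lt _ hi, extend_of_lt _ hk]
  constructor <;> rintro h
  · have : σ ⟨i, hi⟩ = ⟨k, hk⟩ := Fin.ext h
    rw [← this]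
    simp
  · have : σ⁻¹ ⟨k, hk⟩ = ⟨i, hi⟩ := Fin.ext h
    rw [← this]
    simp

theorem wordOf_eq {a : ℕ} (σ : Equiv.Perm (Fin a)) :
    wordOf σ = (List.range a).map (extend σ) := by
  rw [wordOf, ← List.map_coe_finRange_eq_range, List.map_map]
  exact List.map_congr_left fun i _ => (extend_of_lt σ i.2).symm

theorem cellRows_Pchain {a : ℕ} (σ : Equiv.Perm (Fin a)) (k : Fin (a + 1)) :
    cellRows (Pchain σ k) = grid (extend σ) a k := by
  rw [Pchain, RSshape, wordOf_eq]
  exact cellRows_diagramOfRows (isPart_grid (extend_injective σ) a k)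

theorem cellRows_Qchain {a : ℕ} (σ : Equiv.Perm (Fin a)) (i : Fin (a + 1)) :
    cellRows (Qchain σ i) = grid (extend σ) i a := by
  have h : (wordOf σ).take i = ((List.range i).map (extend σ)).filter fun x => x < a := by
    rw [wordOf_eq, ← List.map_take, List.take_range, Nat.min_eq_left (by omega), eq_comm,
      List.filter_eq_self]
    intro x hx
    obtain ⟨i', hi', rfl⟩ := List.mem_map.1 hx
    have := List.mem_range.1 hi'
    simpa using extend_lt σ (by omega)
  rw [Qchain, RSshape, h]
  exact cellRows_diagramOfRows (isPart_grid (extend_injective σ) i a)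

namespace IsGrowth

variable {M : ℕ → ℕ → Prop} {B : ℕ → ℕ → Multiset ℕ} {a b : ℕ}

theorem not_mark_of_lt (h : IsGrowth M B 0 a b) {i k k' : ℕ} (hi : i < a) (hkk : k < k')
    (hk' : k' < b) (hM : M i k) : ¬ M i k' := by
  have hne : B i k' ≠ B (i + 1) k' := by
    have hk : k + 1 ≤ k' := hkk
    induction k', hk using Nat.le_induction with
    | base =>
      rcases h i k (Nat.zero_le _) hi (by omega) with ⟨-, h1, h2, h3⟩ | h1
      · rw [h2, h3]
        exact multiset_ne_cons _ _
      · exact absurd hM h1.1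
    | succ k' hk ih =>
      have ih := ih (by omega) (by omega)
      rcases h i k' (Nat.zero_le _) hi (by omega) with ⟨-, h1, -⟩ | ⟨-, ⟨h1, -⟩ | ⟨h2, h3⟩ |
        ⟨r, s, -, -, h2, h3⟩ | ⟨r, -, h2, h3⟩⟩
      · exact absurd h1.symm ih
      · exact absurd h1.symm ih
      · rwa [h2, h3]
      · rw [h2, h3]
        exact multiset_ne_cons _ _
      · rw [h2, h3]
        exact multiset_ne_cons _ _
  rcases h i k' (Nat.zero_le _) hi hk' with ⟨-, h1, -⟩ | h1
  · exact absurd h1.symm hne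
  · exact h1.1

theorem mark_unique (h : IsGrowth M B 0 a b) {i k k' : ℕ} (hi : i < a) (hk : k < b) (hk' : k' < b)
    (hM : M i k) (hM' : M i k') : k = k' := by
  rcases lt_trichotomy k k' with h1 | h1 | h1
  · exact absurd hM' (h.not_mark_of_lt hi h1 hk' hM)
  · exact h1
  · exact absurd hM (h.not_mark_of_lt hi h1 hk hM')

theorem exists_mark (h : IsGrowth M B 0 a b) {i : ℕ} (hi : i < a) (h0 : B i 0 = B (i + 1) 0)
    (hb : B i b ≠ B (i + 1) b) : ∃ k < b, M i k := by
  by_contra! hno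
  have : ∀ k ≤ b, B i k = B (i + 1) k := by
    intro k
    induction k with
    | zero => exact fun _ => h0
    | succ k ih =>
      intro hk
      have ih := ih (by omega)
      rcases h i k (Nat.zero_le _) hi hk with ⟨h1, -⟩ | ⟨-, ⟨-, h3⟩ | ⟨h2, h3⟩ |
        ⟨r, s, -, h1, -⟩ | ⟨r, h1, -⟩⟩
      · exact absurd h1 (hno k hk)
      · exact h3.symm
      · rw [h2, h3, ih]
      · exact absurd (ih.trans h1) (multiset_ne_cons _ _)
      · exact absurd (ih.trans h1) (multiset_ne_cons _ _)
  exact hb (this b le_rfl)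

theorem exists_perm (h : IsGrowth M B 0 a a) (hrow : ∀ k ≤ a, B 0 k = 0)
    (hcol : ∀ i ≤ a, B i 0 = 0) (hQ : ∀ i < a, B i a ≠ B (i + 1) a) :
    ∃ σ : Equiv.Perm (Fin a), ∀ i ≤ a, ∀ k ≤ a, grid (extend σ) i k = B i k := by
  have hex : ∀ i : Fin a, ∃ k : Fin a, M i k := by
    intro i
    obtain ⟨k, hk, hM⟩ := h.exists_mark i.2 (by rw [hcol _ i.2.le, hcol _ i.2]) (hQ i i.2)
    exact ⟨⟨k, hk⟩, hM⟩
  choose s hs using hex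
  have hinj : s.Injective := by
    intro i i' hi
    refine Fin.ext (h.transpose.mark_unique (s i).2 i.2 i'.2 (hs i) ?_)
    rw [hi]
    exact hs i'
  refine ⟨Equiv.ofBijective s (Finite.injective_iff_bijective.1 hinj), ?_⟩
  refine (isGrowth_grid (extend_injective _) 0 a a).eq_of_forward ?_
    (by simpa using fun k hk => (hrow k hk).symm) (by simpa using fun k hk => (hcol k hk).symm)
  intro i k _ hi hk
  refine (h i k (Nat.zero_le _) hi hk).congr ?_
  change M i k ↔ extend _ i = k
  rw [extend_of_lt _ hi]
  exact ⟨fun hM => h.mark_unique hi (s ⟨i, hi⟩).2 hk (hs ⟨i, hi⟩) hM, fun hM => hM ▸ hs ⟨i, hi⟩⟩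

end IsGrowth

theorem LocalRule.of_cons {p : Prop} {r : ℕ} {l n k : Multiset ℕ}
    (h : LocalRule p l (r ::ₘ l) n k) :
    (n = l ∧ k = r ::ₘ l) ∨ ∃ t, n = t ::ₘ l ∧ k = (if t = r then r + 1 else r) ::ₘ n ∧
      k = (if t = r then r + 1 else t) ::ₘ r ::ₘ l := by
  rcases h with ⟨-, h1, -⟩ | ⟨-, ⟨h1, -⟩ | h2 | ⟨r', s, hrs, h1, h2, h3⟩ | ⟨r', h1, h2, h3⟩⟩
  · exact absurd h1.symm (multiset_ne_cons _ _)
  · exact absurd h1.symm (multiset_ne_cons _ _)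
  · exact Or.inl h2
  · rw [Multiset.cons_inj_left] at h1
    subst h1
    refine Or.inr ⟨s, h2, ?_⟩
    rw [if_neg hrs.symm, if_neg hrs.symm, h2, h3]
    exact ⟨rfl, Multiset.cons_swap _ _ _⟩
  · rw [Multiset.cons_inj_left] at h1
    subst h1
    refine Or.inr ⟨r, h2, ?_⟩
    simp [h2, h3]

theorem exists_grid_succ {f : ℕ → ℕ} {i k : ℕ} (h : f i < k) :
    ∃ r, grid f (i + 1) k = r ::ₘ grid f i k := by
  rw [grid, gridTab_succ_of_lt h, grid]
  exact exists_rowMultiset_insertTab _ _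

theorem grid_mark {f : ℕ → ℕ} (hf : f.Injective) (i : ℕ) :
    grid f (i + 1) (f i) = grid f i (f i) ∧ grid f i (f i + 1) = grid f i (f i) ∧
      grid f (i + 1) (f i + 1) = 0 ::ₘ grid f i (f i) := by
  rcases localRule_grid hf i (f i) with ⟨-, h⟩ | h
  · exact h
  · exact absurd rfl h.1

/-- How the rows of two consecutive insertions change from one column to the next. -/
theorem grid_two_steps {f : ℕ → ℕ} (hf : f.Injective) {i k r s : ℕ}
    (h1 : grid f (i + 1) k = r ::ₘ grid f i k)
    (h2 : grid f (i + 2) k = s ::ₘ grid f (i + 1) k) :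
    ∃ r' s', grid f (i + 1) (k + 1) = r' ::ₘ grid f i (k + 1) ∧
      grid f (i + 2) (k + 1) = s' ::ₘ grid f (i + 1) (k + 1) ∧ (r < s ↔ r' < s') := by
  have hr := localRule_grid hf i k
  have hs := localRule_grid hf (i + 1) k
  rw [h1] at hr
  rw [show i + 1 + 1 = i + 2 from rfl, h2] at hs
  rcases hr.of_cons with ⟨h3, h4⟩ | ⟨t, h3, h4, h5⟩ <;>
  rcases hs.of_cons with ⟨h6, h7⟩ | ⟨u, h6, h7, h8⟩
  · exact ⟨r, s, by rw [h4, h3], by rw [h7, h6], Iff.rfl⟩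
  · rw [h4, h1] at h6
    exact absurd h6 (multiset_ne_cons _ _)
  · rw [h5, h1] at h6
    exact absurd h6.symm (multiset_ne_cons _ _)
  · refine ⟨_, _, h4, h7, ?_⟩
    rw [h5, h1, Multiset.cons_inj_left] at h6
    subst h6
    grind

theorem exists_rows_of_ascent {f : ℕ → ℕ} (hf : f.Injective) {i k : ℕ} (h : f i < f (i + 1))
    (hk : f (i + 1) + 1 ≤ k) :
    ∃ r s, grid f (i + 1) k = r ::ₘ grid f i k ∧ grid f (i + 2) k = s ::ₘ grid f (i + 1) k ∧
      ¬ r < s := by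
  induction k, hk using Nat.le_induction with
  | base =>
    obtain ⟨h1, h2, h3⟩ := grid_mark hf (i + 1)
    obtain ⟨r, hr⟩ := exists_grid_succ (h.trans (Nat.lt_succ_self _))
    exact ⟨r, 0, hr, by rw [h2, ← h3], by omega⟩
  | succ k hk ih =>
    obtain ⟨r, s, h1, h2, h3⟩ := ih
    obtain ⟨r', s', h4, h5, h6⟩ := grid_two_steps hf h1 h2
    exact ⟨r', s', h4, h5, by rwa [← h6]⟩

theorem exists_rows_of_descent {f : ℕ → ℕ} (hf : f.Injective) {i k : ℕ} (h : f (i + 1) < f i)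
    (hk : f i + 1 ≤ k) :
    ∃ r s, grid f (i + 1) k = r ::ₘ grid f i k ∧ grid f (i + 2) k = s ::ₘ grid f (i + 1) k ∧
      r < s := by
  induction k, hk using Nat.le_induction with
  | base =>
    obtain ⟨h1, h2, h3⟩ := grid_mark hf i
    obtain ⟨s, hs⟩ := exists_grid_succ h
    have hr := localRule_grid hf (i + 1) (f i)
    rw [hs, show i + 1 + 1 = i + 2 from rfl] at hr
    rcases hr.of_cons with ⟨h6, -⟩ | ⟨u, h6, h7, -⟩
    · rw [h1, h3] at h6
      exact absurd h6.symm (multiset_ne_cons _ _)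
    · refine ⟨0, _, by rw [h2, h3], h7, ?_⟩
      rw [h1, h3, Multiset.cons_inj_left] at h6
      subst h6
      grind
  | succ k hk ih =>
    obtain ⟨r, s, h1, h2, h3⟩ := ih
    obtain ⟨r', s', h4, h5, h6⟩ := grid_two_steps hf h1 h2
    exact ⟨r', s', h4, h5, by rwa [← h6]⟩

theorem descent_iff {f : ℕ → ℕ} (hf : f.Injective) {i k r s : ℕ} (hk : f i < k)
    (hk' : f (i + 1) < k) (hr : grid f (i + 1) k = r ::ₘ grid f i k)
    (hs : grid f (i + 2) k = s ::ₘ grid f (i + 1) k) : f (i + 1) < f i ↔ r < s := by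
  rcases lt_trichotomy (f i) (f (i + 1)) with h | h | h
  · obtain ⟨r', s', h1, h2, h3⟩ := exists_rows_of_ascent hf h hk'
    rw [hr, Multiset.cons_inj_left] at h1
    rw [hs, Multiset.cons_inj_left] at h2
    subst h1 h2
    simp [h3, h.le]
  · exact absurd (hf h) (by simp)
  · obtain ⟨r', s', h1, h2, h3⟩ := exists_rows_of_descent hf h hk
    rw [hr, Multiset.cons_inj_left] at h1
    rw [hs, Multiset.cons_inj_left] at h2
    subst h1 h2
    simp [h3, h]

theorem standardize_lt_iff {n k : ℕ} (v : Fin k → Fin n) (hv : v.Injective) (i i' : Fin k) :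
    standardize v hv i < standardize v hv i' ↔ v i < v i' := by
  simp [standardize]

theorem maj_pTail {a : ℕ} (σ : Equiv.Perm (Fin a)) (j : ℕ) :
    maj (pTail σ j) = chainMaj (tailChain (Qchain σ) j) := by
  rw [maj, chainMaj]
  refine sum_congr rfl fun i _ => ?_
  by_cases h : i + 1 < a - j
  · have hrow : ∀ t, t < a - j → grid (extend σ) (j + t + 1) a =
        rowOfStep (tailChain (Qchain σ) j) t ::ₘ grid (extend σ) (j + t) a := by
      intro t ht
      obtain ⟨r, hr⟩ := exists_grid_succ (extend_lt σ (show j + t < a by omega))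
      rw [rowOfStep_eq (r := r) ht, hr]
      simp only [tailChain, cellRows_Qchain, ← add_assoc]
      rw [min_eq_left (by omega), min_eq_left (by omega), hr]
    rw [dif_pos h]
    have hd := descent_iff (extend_injective σ) (extend_lt σ (show j + i < a by omega))
      (extend_lt σ (show j + i + 1 < a by omega)) (hrow i (by omega)) (hrow (i + 1) h)
    rw [extend_of_lt σ (by omega), extend_of_lt σ (by omega), Fin.val_fin_lt] at hd
    simp only [h, true_and, ← hd]
    congr 1
    exact propext (standardize_lt_iff _ _ _ _)
  · rw [dif_neg h, if_neg (by tauto)]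

theorem card_filter_extend_lt {n c : ℕ} (τ : Equiv.Perm (Fin n)) (hc : c ≤ n) :
    #{i ∈ range n | extend τ i < c} = c := by
  rw [← card_image_of_injective _ (extend_injective τ)]
  convert card_range c
  ext x
  simp only [mem_image, mem_filter, mem_range]
  constructor
  · rintro ⟨i, ⟨-, h⟩, rfl⟩
    exact h
  · intro hx
    have hx' : x < n := by omega
    have h := (extend_inv τ (extend_lt τ⁻¹ hx') hx').2 rfl
    exact ⟨extend τ⁻¹ x, ⟨extend_lt _ hx', by rwa [h]⟩, h⟩

theorem extend_pInit_lt_iff {a j : ℕ} (σ : Equiv.Perm (Fin a)) (hj : j ≤ a) {i i' : ℕ}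
    (hi : i < j) (hi' : i' < j) :
    extend (pInit σ j hj) i < extend (pInit σ j hj) i' ↔ extend σ i < extend σ i' := by
  rw [extend_of_lt _ hi, extend_of_lt _ hi', extend_of_lt _ (hi.trans_le hj),
    extend_of_lt _ (hi'.trans_le hj), Fin.val_fin_lt, Fin.val_fin_lt]
  exact standardize_lt_iff _ _ _ _

theorem extend_pInit {a j : ℕ} (σ : Equiv.Perm (Fin a)) (hj : j ≤ a) {i : ℕ} (hi : i < j) :
    extend (pInit σ j hj) i = #{i' ∈ range j | extend σ i' < extend σ i} := by
  rw [← card_filter_extend_lt (pInit σ j hj) (extend_lt _ hi).le]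
  congr 1
  refine filter_congr fun i' hi' => ?_
  exact extend_pInit_lt_iff σ hj (mem_range.1 hi') hi

theorem grid_pInit {a j : ℕ} (σ : Equiv.Perm (Fin a)) (hj : j ≤ a) :
    ∀ i ≤ j, ∀ k ≤ a, grid (extend σ) i k =
      grid (extend (pInit σ j hj)) i #{i' ∈ range j | extend σ i' < k} := by
  refine (isGrowth_grid (extend_injective σ) 0 j a).eq_of_forward
    (B' := fun i k => grid (extend (pInit σ j hj)) i #{i' ∈ range j | extend σ i' < k})
    ?_ (by simp) (by simp)
  intro i k _ hi hk
  change LocalRule (extend σ i = k) _ _ _ _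
  by_cases h : ∃ i₀ < j, extend σ i₀ = k
  · obtain ⟨i₀, hi₀, rfl⟩ := h
    have hs : #{i' ∈ range j | extend σ i' < extend σ i₀ + 1} =
        #{i' ∈ range j | extend σ i' < extend σ i₀} + 1 := by
      rw [← card_insert_of_notMem (s := {i' ∈ range j | extend σ i' < extend σ i₀}) (a := i₀)
        (by simp)]
      congr 1
      ext x
      simp only [mem_filter, mem_range, mem_insert, Nat.lt_succ_iff_lt_or_eq,
        (extend_injective σ).eq_iff]
      grind
    simp only [hs]
    refine (localRule_grid (extend_injective _) i _).congr ?_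
    rw [← extend_pInit σ hj hi₀, (extend_injective _).eq_iff, (extend_injective _).eq_iff]
  · push Not at h
    have hs : #{i' ∈ range j | extend σ i' < k + 1} = #{i' ∈ range j | extend σ i' < k} := by
      congr 1
      refine filter_congr fun x hx => ?_
      have := h x (mem_range.1 hx)
      omega
    simp only [hs]
    exact Or.inr ⟨h i hi, Or.inr (Or.inl ⟨rfl, rfl⟩)⟩

theorem exists_card_eq (C : ℕ → Multiset ℕ) (b : ℕ) (h0 : C 0 = 0)
    (hC : ∀ k < b, WeakStep (C k) (C (k + 1))) :
    ∀ c ≤ (C b).card, ∃ k ≤ b, (C k).card = c := by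
  induction b with
  | zero =>
    intro c hc
    exact ⟨0, le_rfl, by simp_all⟩
  | succ b ih =>
    intro c hc
    have ih := ih (fun k hk => hC k (by omega)) c
    by_cases h : c ≤ (C b).card
    · obtain ⟨k, hk, rfl⟩ := ih h
      exact ⟨k, by omega, rfl⟩
    · refine ⟨b + 1, le_rfl, ?_⟩
      rcases hC b (by omega) with h' | ⟨r, h'⟩ <;> rw [h'] at hc ⊢
      · omega
      · rw [Multiset.card_cons] at *
        omega

theorem weakStep_grid_right {f : ℕ → ℕ} (hf : f.Injective) (i k : ℕ) :
    WeakStep (grid f i k) (grid f i (k + 1)) := by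
  rcases gridTab_column hf i k with h | ⟨r, hr⟩
  · exact Or.inl (by rw [grid, grid, h])
  · exact Or.inr ⟨r, hr.rowMultiset_eq⟩

/-- The standardized prefix of length `j` is an involution exactly when its insertion and
recording tableaux agree. -/
theorem pInit_mul_self_iff {a j : ℕ} (σ : Equiv.Perm (Fin a)) (hj : j ≤ a) :
    pInit σ j hj * pInit σ j hj = 1 ↔ ∀ k ≤ a, grid (extend σ) j k =
      grid (extend σ) (grid (extend σ) j k).card a := by
  have hja : #{i ∈ range j | extend σ i < a} = j := by
    rw [filter_true_of_mem fun i hi => extend_lt σ ((mem_range.1 hi).trans_le hj), card_range]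
  have hle : ∀ k, #{i ∈ range j | extend σ i < k} ≤ j := fun k =>
    (card_filter_le _ _).trans_eq (card_range j)
  set τ := pInit σ j hj with hτ
  have hsymm : ∀ i ≤ j, ∀ k ≤ j, grid (extend τ) i k = grid (extend τ⁻¹) k i :=
    grid_symm (extend_injective _) (extend_injective _) fun i hi k hk => extend_inv τ hi hk
  have hiff : (∀ k ≤ a, grid (extend σ) j k = grid (extend σ) (grid (extend σ) j k).card a) ↔
      ∀ c ≤ j, grid (extend τ) j c = grid (extend τ) c j := by
    constructor
    · intro h c hc
      obtain ⟨k, hk, rfl⟩ := exists_card_eq (grid (extend σ) j) a (by simp)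
        (fun k _ => weakStep_grid_right (extend_injective σ) j k) c (by rwa [card_grid, hja])
      have := h k hk
      rw [card_grid, grid_pInit σ hj j le_rfl k hk, grid_pInit σ hj _ (hle k) a le_rfl, hja] at this
      rwa [card_grid]
    · intro h k hk
      rw [card_grid, grid_pInit σ hj j le_rfl k hk, grid_pInit σ hj _ (hle k) a le_rfl, hja]
      exact h _ (hle k)
  rw [hiff, mul_eq_one_iff_eq_inv]
  constructor
  · intro h c hc
    rw [hsymm j le_rfl c hc, ← h]
  · intro h
    refine perm_ext_of_extend fun i hi k hk => ?_
    refine ((isGrowth_grid (extend_injective τ) 0 j j).backward_unique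
      (isGrowth_grid (extend_injective τ⁻¹) 0 j j) ?_ ?_).2 i (Nat.zero_le _) hi k hk
    · intro k hk
      rw [h k hk, hsymm k hk j le_rfl]
    · intro i _ hi
      rw [← h i hi, hsymm j le_rfl i hi]

/-- The chain obtained from a weakly increasing one by deleting repetitions. -/
theorem exists_strict_chain (C : ℕ → Multiset ℕ) (b : ℕ) (h0 : C 0 = 0)
    (hC : ∀ k < b, WeakStep (C k) (C (k + 1))) (hP : ∀ k ≤ b, IsPart (C k)) :
    ∃ Q : ℕ → Multiset ℕ, (∀ k ≤ b, Q (C k).card = C k) ∧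
      (∀ i < (C b).card, ∃ r, Q (i + 1) = r ::ₘ Q i) ∧ ∀ i ≤ (C b).card, IsPart (Q i) := by
  have hmono : ∀ n ≤ b, ∀ k ≤ n, (C k).card ≤ (C n).card := by
    intro n hn k hk
    induction n, hk using Nat.le_induction with
    | base => exact le_rfl
    | succ n hk ih =>
      refine (ih (by omega)).trans ?_
      rcases hC n (by omega) with h | ⟨r, h⟩ <;> simp [h]
  induction b with
  | zero =>
    refine ⟨fun _ => 0, fun k hk => ?_, by simp [h0], fun _ _ => isPart_zero⟩
    obtain rfl : k = 0 := by omega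
    exact h0.symm
  | succ b ih =>
    obtain ⟨Q, h1, h2, h3⟩ := ih (fun k hk => hC k (by omega)) (fun k hk => hP k (by omega))
      (fun n hn => hmono n (by omega))
    rcases hC b (by omega) with h | ⟨r, h⟩
    · refine ⟨Q, fun k hk => ?_, by rwa [h], by rwa [h]⟩
      rcases Nat.le_succ_iff.1 hk with hk | rfl
      · exact h1 k hk
      · rw [Nat.succ_eq_add_one, h, h1 b le_rfl]
    · have hc : (C (b + 1)).card = (C b).card + 1 := by rw [h, Multiset.card_cons]
      refine ⟨fun i => if i ≤ (C b).card then Q i else C (b + 1), fun k hk => ?_, ?_, ?_⟩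
      · rcases Nat.le_succ_iff.1 hk with hk | rfl
        · simpa [hmono b (by omega) k hk] using h1 k hk
        · simp [hc]
      · intro i hi
        rw [hc, Nat.lt_succ_iff_lt_or_eq] at hi
        rcases hi with hi | rfl
        · simpa [hi, hi.le, Nat.succ_le_iff] using h2 i hi
        · simpa [h1 b le_rfl] using ⟨r, h⟩
      · intro i hi
        by_cases h : i ≤ (C b).card
        · simpa [h] using h3 i h
        · simpa [h] using hP (b + 1) le_rfl

theorem IsGrowth.shift {M : ℕ → ℕ → Prop} {B : ℕ → ℕ → Multiset ℕ} {j a b : ℕ}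
    (h : IsGrowth M B j a b) :
    IsGrowth (fun i => M (j + i)) (fun i => B (j + i)) 0 (a - j) b := fun i k _ hi hk =>
  h (j + i) k (by omega) (by omega) hk

theorem WeakStep.eq_zero {C : ℕ → Multiset ℕ} {n : ℕ} (hC : ∀ i < n, WeakStep (C i) (C (i + 1)))
    (hn : C n = 0) : ∀ i ≤ n, C i = 0 := by
  intro i hi
  induction hi using Nat.decreasingInduction with
  | self => exact hn
  | of_succ i hi ih =>
    rcases hC i hi with h | ⟨r, h⟩ <;> rw [ih] at h
    · exact h.symm
    · exact absurd h.symm (Multiset.cons_ne_zero)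

/-- A chain of Young diagrams as an eventually constant sequence of multisets. -/
def natChain {n : ℕ} (c : Fin (n + 1) → YoungDiagram) (i : ℕ) : Multiset ℕ :=
  cellRows (c ⟨min i n, by omega⟩)

theorem natChain_of_le {n i : ℕ} (c : Fin (n + 1) → YoungDiagram) (hi : i ≤ n) :
    natChain c i = cellRows (c ⟨i, by omega⟩) := by
  simp only [natChain, min_eq_left hi]

theorem IsSYTChain.natChain_succ {n : ℕ} {c : Fin (n + 1) → YoungDiagram} (h : IsSYTChain c)
    {i : ℕ} (hi : i < n) : ∃ r, natChain c (i + 1) = r ::ₘ natChain c i := by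
  rw [natChain_of_le c hi.le, natChain_of_le c hi]
  exact isSYTChain_iff.1 h i hi

theorem chain_ext {n : ℕ} {c d : Fin (n + 1) → YoungDiagram}
    (h : ∀ i ≤ n, natChain c i = natChain d i) : c = d := by
  funext i
  have := h i (by omega)
  rw [natChain_of_le c (by omega), natChain_of_le d (by omega)] at this
  exact cellRows_injective this

theorem natChain_Pchain {a k : ℕ} (σ : Equiv.Perm (Fin a)) (hk : k ≤ a) :
    natChain (Pchain σ) k = grid (extend σ) a k := by
  rw [natChain_of_le _ hk, cellRows_Pchain]

theorem natChain_tailChain_Qchain {a i j : ℕ} (σ : Equiv.Perm (Fin a)) (hj : j ≤ a)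
    (hi : i ≤ a - j) :
    natChain (tailChain (Qchain σ) j) i = grid (extend σ) (j + i) a := by
  rw [natChain_of_le _ hi, tailChain, cellRows_Qchain]
  simp only [min_eq_left (show j + i ≤ a by omega)]

theorem exists_perm_of_chains {a j : ℕ} (hj : j ≤ a) {α μ : YoungDiagram}
    {A : Fin (a + 1) → YoungDiagram} (hA : A ∈ skewSYT ⊥ α a)
    {T : Fin (a - j + 1) → YoungDiagram} (hT : T ∈ skewSYT μ α (a - j)) (hμ : μ.card = j) :
    ∃ σ : Equiv.Perm (Fin a), Pchain σ = A ∧ pInit σ j hj * pInit σ j hj = 1 ∧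
      tailChain (Qchain σ) j = T := by
  obtain ⟨hA0, hAl, hAc⟩ := mem_skewSYT.1 hA
  obtain ⟨hT0, hTl, hTc⟩ := mem_skewSYT.1 hT
  have hA0' : natChain A 0 = 0 := by
    rw [natChain_of_le _ (Nat.zero_le _), ← cellRows_bot, ← hA0]
    rfl
  have hAl' : natChain A a = cellRows α := by
    rw [natChain_of_le _ le_rfl, ← hAl]
    rfl
  have hT0' : natChain T 0 = cellRows μ := by
    rw [natChain_of_le _ (Nat.zero_le _), ← hT0]
    rfl
  have hTl' : natChain T (a - j) = cellRows α := by
    rw [natChain_of_le _ le_rfl, ← hTl]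
    rfl
  have hAs : ∀ k < a, WeakStep (natChain A k) (natChain A (k + 1)) := fun k hk =>
    Or.inr (hAc.natChain_succ hk)
  obtain ⟨M₀, D, hD, hDrow, hDcol, hDP, hDs, hD0⟩ := exists_growth (a - j) a (natChain A)
    (natChain T) hAs (fun _ _ => isPart_cellRows _) (fun i hi => Or.inr (hTc.natChain_succ hi))
    (fun _ _ => isPart_cellRows _) (hAl'.trans hTl'.symm)
  have hD00 : D 0 0 = 0 := WeakStep.eq_zero (C := fun i => D i 0) hD0
    (by rw [hDrow 0 (Nat.zero_le _), hA0']) 0 (Nat.zero_le _)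
  have hDa : (D 0 a).card = j := by
    rw [hDcol 0 (Nat.zero_le _), hT0', card_cellRows, hμ]
  obtain ⟨Q, hQ, hQs, hQP⟩ := exists_strict_chain (D 0) a hD00 hDs hDP
  rw [hDa] at hQs hQP
  have hQj : Q j = natChain T 0 := by
    rw [← hDcol 0 (Nat.zero_le _), ← hQ a le_rfl, hDa]
  have hQ0 : Q 0 = 0 := by
    rw [← hD00, ← hQ 0 (Nat.zero_le _), hD00, Multiset.card_zero]
  set Q' : ℕ → Multiset ℕ := fun i => if i ≤ j then Q i else natChain T (i - j) with hQ'
  have hQ'T : ∀ i, Q' (j + i) = natChain T i := by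
    intro i
    by_cases hi : i = 0
    · simpa [hQ', hi] using hQj
    · simp [hQ', hi]
  have hQ's : ∀ i < a, ∃ r, Q' (i + 1) = r ::ₘ Q' i := by
    intro i hi
    by_cases h : i < j
    · simpa [hQ', h, h.le, Nat.succ_le_iff] using hQs i h
    · obtain ⟨t, rfl⟩ := Nat.exists_eq_add_of_le (not_lt.1 h)
      rw [add_assoc, hQ'T, hQ'T]
      exact hTc.natChain_succ (by omega)
  obtain ⟨M, B, hB, hBrow, hBcol, -, hBs, hB0⟩ := exists_growth a a (natChain A) Q' hAs
    (fun _ _ => isPart_cellRows _) (fun i hi => Or.inr (hQ's i hi))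
    (fun i _ => by
      by_cases h : i ≤ j
      · simpa [hQ', h] using hQP i h
      · rw [show Q' i = natChain T (i - j) by simp [hQ', h]]
        exact isPart_cellRows _)
    (by rw [hAl', ← hTl', ← hQ'T, Nat.add_sub_cancel' hj])
  obtain ⟨σ, hσ⟩ := hB.exists_perm
    (WeakStep.eq_zero hBs (by rw [hBcol 0 (Nat.zero_le _)]; simpa [hQ'] using hQ0))
    (WeakStep.eq_zero (C := fun i => B i 0) hB0 (by rw [hBrow 0 (Nat.zero_le _), hA0']))
    (fun i hi => by
      rw [hBcol i hi.le, hBcol (i + 1) hi]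
      obtain ⟨r, hr⟩ := hQ's i hi
      rw [hr]
      exact multiset_ne_cons _ _)
  have hBD : ∀ k ≤ a, B j k = D 0 k := by
    refine ((hB.mono (Nat.zero_le j) le_rfl le_rfl).shift.backward_unique hD ?_ ?_).1 0
      le_rfl (Nat.zero_le _)
    · intro k hk
      rw [Nat.add_sub_cancel' hj, hBrow k hk, hDrow k hk]
    · intro i _ hi
      rw [hBcol _ (by omega), hDcol _ hi, hQ'T]
  refine ⟨σ, chain_ext fun k hk => ?_, (pInit_mul_self_iff σ hj).2 fun k hk => ?_,
    chain_ext fun i hi => ?_⟩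
  · rw [natChain_Pchain σ hk, hσ a le_rfl k hk, hBrow k hk]
  · have hle : (D 0 k).card ≤ j := by
      rw [← hBD k hk, ← hσ j hj k hk, card_grid]
      exact (card_filter_le _ _).trans_eq (card_range j)
    rw [hσ j hj k hk, hBD k hk, hσ _ (hle.trans hj) a le_rfl, hBcol _ (hle.trans hj), hQ']
    simp only [if_pos hle, hQ k hk]
  · rw [natChain_tailChain_Qchain σ hj hi, hσ _ (by omega) a le_rfl, hBcol _ (by omega), hQ'T]

theorem perm_ext_of_chains {a j : ℕ} (hj : j ≤ a) {σ τ : Equiv.Perm (Fin a)}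
    (hσ : pInit σ j hj * pInit σ j hj = 1) (hτ : pInit τ j hj * pInit τ j hj = 1)
    (hP : Pchain σ = Pchain τ)
    (hQ : tailChain (Qchain σ) j = tailChain (Qchain τ) j) : σ = τ := by
  have hrow : ∀ k ≤ a, grid (extend σ) a k = grid (extend τ) a k := fun k hk => by
    rw [← natChain_Pchain σ hk, hP, natChain_Pchain τ hk]
  have hcol : ∀ i, j ≤ i → i ≤ a → grid (extend σ) i a = grid (extend τ) i a := by
    intro i hji hia
    obtain ⟨t, rfl⟩ := Nat.exists_eq_add_of_le hji
    rw [← natChain_tailChain_Qchain σ hj (by omega), hQ,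
      natChain_tailChain_Qchain τ hj (by omega)]
  have hj_row := ((isGrowth_grid (extend_injective σ) j a a).backward_unique
    (isGrowth_grid (extend_injective τ) j a a) hrow hcol).1 j le_rfl hj
  rw [pInit_mul_self_iff] at hσ hτ
  refine perm_ext_of_extend fun i hi k hk =>
    ((isGrowth_grid (extend_injective σ) 0 a a).backward_unique
      (isGrowth_grid (extend_injective τ) 0 a a) hrow fun i _ hia => ?_).2 i (Nat.zero_le _) hi k hk
  rcases le_total j i with h | h
  · exact hcol i h hia
  · have hcard : (grid (extend σ) j a).card = j := by
      rw [card_grid, filter_true_of_mem fun i hi => extend_lt σ ((mem_range.1 hi).trans_le hj),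
        card_range]
    obtain ⟨k, hk, rfl⟩ := exists_card_eq (grid (extend σ) j) a (by simp)
      (fun k _ => weakStep_grid_right (extend_injective σ) j k) i (by rwa [hcard])
    rw [← hσ k hk, hj_row k hk, ← hτ k hk]

theorem tailChain_Qchain_mem_skewSYT {a j : ℕ} (hj : j ≤ a) (σ : Equiv.Perm (Fin a)) :
    tailChain (Qchain σ) j ∈
      skewSYT (tailChain (Qchain σ) j 0) (Pchain σ (Fin.last a)) (a - j) := by
  refine mem_skewSYT.2 ⟨rfl, cellRows_injective ?_, isSYTChain_iff.2 fun i hi => ?_⟩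
  · have h := natChain_tailChain_Qchain σ hj le_rfl
    rw [natChain_of_le _ le_rfl, Nat.add_sub_cancel' hj] at h
    rw [cellRows_Pchain, Fin.val_last]
    exact h
  · have h1 := natChain_tailChain_Qchain σ hj hi.le
    have h2 := natChain_tailChain_Qchain σ hj hi
    rw [natChain_of_le _ hi.le] at h1
    rw [natChain_of_le _ hi] at h2
    rw [h1, h2]
    exact exists_grid_succ (extend_lt σ (show j + i < a by omega))

theorem card_tailChain_Qchain_zero {a j : ℕ} (hj : j ≤ a) (σ : Equiv.Perm (Fin a)) :
    (tailChain (Qchain σ) j 0).card = j := by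
  have h := natChain_tailChain_Qchain σ hj (Nat.zero_le _)
  rw [natChain_of_le _ (Nat.zero_le _)] at h
  rw [← card_cellRows]
  refine (congrArg Multiset.card h).trans ?_
  rw [add_zero, card_grid,
    filter_true_of_mem fun i hi => extend_lt σ ((mem_range.1 hi).trans_le hj), card_range]

theorem mem_jSet {a j : ℕ} {σ : Equiv.Perm (Fin a)} :
    j ∈ jSet σ ↔ ∃ h : j ≤ a, pInit σ j h * pInit σ j h = 1 := by
  classical
  simp only [jSet, mem_filter, mem_range, and_iff_right_iff_imp]
  rintro ⟨h, -⟩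
  omega

open scoped Classical in
/-- For a standard Young tableau `A` of shape `α ⊢ a` and `j ≥ 0`,
`Σ_{σ : P(σ) = A, j ∈ J(σ)} q^{maj(σ^{>j})} = Σ_{μ ⊢ j, μ ⊆ α} f^{α/μ}(q)`. -/
theorem stmt9 {a : ℕ} (α : YoungDiagram) (hα : α.card = a)
    (A : Fin (a + 1) → YoungDiagram) (hA : A ∈ skewSYT ⊥ α a) (j : ℕ) (q : ℝ) :
    ∑ σ ∈ (Finset.univ.filter
        fun σ : Equiv.Perm (Fin a) => Pchain σ = A ∧ j ∈ jSet σ),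
        q ^ maj (pTail σ j) =
      ∑ μ ∈ (subDiagrams α).filter (fun μ => μ.card = j), fSkew μ α (a - j) q := by
  rcases lt_or_ge a j with hj | hj
  · rw [filter_false_of_mem, filter_false_of_mem, sum_empty, sum_empty]
    · intro μ hμ h
      have := card_le_card (show μ.cells ⊆ α.cells from mem_subDiagrams.1 hμ)
      change μ.card ≤ α.card at this
      omega
    · rintro σ - ⟨-, h⟩
      obtain ⟨h, -⟩ := mem_jSet.1 h
      omega
  obtain ⟨-, hAl, -⟩ := mem_skewSYT.1 hA
  unfold fSkew
  rw [sum_sigma']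
  refine sum_bij (fun σ _ => ⟨tailChain (Qchain σ) j 0, tailChain (Qchain σ) j⟩) ?_ ?_ ?_ ?_
  · intro σ hσ
    obtain ⟨hP, -⟩ := (mem_filter.1 hσ).2
    have h := tailChain_Qchain_mem_skewSYT hj σ
    rw [hP, hAl] at h
    refine mem_sigma.2 ⟨mem_filter.2 ⟨?_, card_tailChain_Qchain_zero hj σ⟩, h⟩
    exact Fintype.mem_piFinset.1 (mem_filter.1 h).1 0
  · intro σ hσ τ hτ h
    obtain ⟨hσP, hσJ⟩ := (mem_filter.1 hσ).2
    obtain ⟨hτP, hτJ⟩ := (mem_filter.1 hτ).2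
    exact perm_ext_of_chains hj (mem_jSet.1 hσJ).2 (mem_jSet.1 hτJ).2 (hσP.trans hτP.symm)
      (eq_of_heq (Sigma.mk.inj h).2)
  · rintro ⟨μ, T⟩ h
    obtain ⟨hμ, hT⟩ := mem_sigma.1 h
    obtain ⟨σ, hσP, hσJ, rfl⟩ := exists_perm_of_chains hj hA hT (mem_filter.1 hμ).2
    refine ⟨σ, mem_filter.2 ⟨mem_univ _, hσP, mem_jSet.2 ⟨hj, hσJ⟩⟩, ?_⟩
    have h0 : tailChain (Qchain σ) j 0 = μ := (mem_skewSYT.1 hT).1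
    rw [h0]
  · intro σ _
    rw [maj_pTail σ j]

end QT
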